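/- arXiv:2211.03302 — 2 statements merged into one kernel-verified Lean document; each statement's English description precedes it below -/
import Mathlib

section
/- (Constant approximation by simple scoring rules) Suppose the value is additive, v(Ψ) = Σ_{i∈Ψ} v_i with v_i ≥ 0, and p_i ≥ 2c_i for all tasks i. Let IC-OPT be the maximum of v(Ψ) over incentive compatible mechanisms (S, Ψ) with S taking values in [0,1]. Then there exists an incentive compatible mechanism (S, Ψ) with S taking values in [0,1] such that S is either a truncated separate scoring rule or a threshold scoring rule and 1091·v(Ψ) ≥ IC-OPT. -/
open Finset

namespace KS

abbrev Sig (n : ℕ) := Fin n → Option Bool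
abbrev St (n : ℕ) := Fin n → Bool

/-- Posterior probability of state profile `ω` induced by signal profile `σ`:
`ω i = b` with probability 1 when `σ i = some b`, uniform when `σ i = none`. -/
noncomputable def postProb {n : ℕ} (σ : Sig n) (ω : St n) : ℝ :=
  ∏ i, (σ i).elim ((1:ℝ)/2) (fun b => if ω i = b then 1 else 0)

/-- Expectation of `f` over states, under the posterior induced by `σ`. -/
noncomputable def postExp {n : ℕ} (σ : Sig n) (f : St n → ℝ) : ℝ :=
  ∑ ω : St n, postProb σ ω * f ω

/-- A scoring rule is proper if truthful reporting of the signal maximizes the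
expected score under the induced posterior. -/
def Proper {n : ℕ} (S : Sig n → St n → ℝ) : Prop :=
  ∀ σ σ' : Sig n, postExp σ (S σ) ≥ postExp σ (S σ')

/-- Probability of receiving signal profile `σ` when exerting effort exactly on `Ψ`
(with state-revelation probabilities `p`, states uniform and independent). -/
noncomputable def sigProb {n : ℕ} (p : Fin n → ℝ) (Ψ : Finset (Fin n)) (σ : Sig n) : ℝ :=
  ∏ i, if i ∈ Ψ then (σ i).elim (1 - p i) (fun _ => p i / 2)
       else (σ i).elim 1 (fun _ => 0)

/-- Expected score `E_{σ∼Ψ}[E_{ω∼σ}[S(σ,ω)]]` for exerting effort on `Ψ` and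
truthfully reporting. -/
noncomputable def expScore {n : ℕ} (p : Fin n → ℝ) (Ψ : Finset (Fin n))
    (S : Sig n → St n → ℝ) : ℝ :=
  ∑ σ : Sig n, sigProb p Ψ σ * postExp σ (S σ)

/-- Incentive compatibility of the mechanism `(S, Ψ)`. -/
def IC {n : ℕ} (p c : Fin n → ℝ) (S : Sig n → St n → ℝ) (Ψ : Finset (Fin n)) : Prop :=
  Proper S ∧ ∀ Ψ' : Finset (Fin n),
    expScore p Ψ S - ∑ i ∈ Ψ, c i ≥ expScore p Ψ' S - ∑ i ∈ Ψ', c i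

/-- Truncated separate scoring rule with budget `B`. -/
def IsTruncSep {n : ℕ} (B : ℝ) (S : Sig n → St n → ℝ) : Prop :=
  ∃ (T : Fin n → Option Bool → Bool → ℝ) (d : ℝ),
    ∀ σ ω, S σ ω = min B (max 0 (-d + ∑ i, T i (σ i) (ω i)))

open Classical in
/-- Threshold scoring rule with recommendation set `Ψ` and threshold `η`. -/
noncomputable def thresholdScore {n : ℕ} (Ψ : Finset (Fin n)) (η : ℕ)
    (σ : Sig n) (ω : St n) : ℝ :=
  if ∃ i ∈ Ψ, σ i ≠ none ∧ σ i ≠ some (ω i) then 0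
  else if η ≤ (Ψ.filter fun i => σ i = some (ω i)).card then 1
  else (1/2 : ℝ) ^ (η - (Ψ.filter fun i => σ i = some (ω i)).card)

def IsThreshold {n : ℕ} (S : Sig n → St n → ℝ) : Prop :=
  ∃ (Ψ : Finset (Fin n)) (η : ℕ), ∀ σ ω, S σ ω = thresholdScore Ψ η σ ω

end KS

namespace KS

/-- The signal profile revealing exactly the states of the tasks in `R`. -/
def reveal {n : ℕ} (R : Finset (Fin n)) (ω : St n) : Sig n :=
  fun i => if i ∈ R then some (ω i) else none

/-- Expected truthful score when exactly the tasks in `R` are revealed. -/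
noncomputable def avgScore {n : ℕ} (S : Sig n → St n → ℝ) (R : Finset (Fin n)) : ℝ :=
  (1 / 2) ^ n * ∑ ω : St n, S (reveal R ω) ω

/-- Expectation of `φ R`, where `R ⊆ A` contains each `i ∈ A` independently with
probability `p i`. -/
noncomputable def revExp {n : ℕ} (p : Fin n → ℝ) (A : Finset (Fin n))
    (φ : Finset (Fin n) → ℝ) : ℝ :=
  ∑ R ∈ A.powerset, (∏ i ∈ R, p i) * (∏ i ∈ A \ R, (1 - p i)) * φ R

section revExp

variable {n : ℕ} {p : Fin n → ℝ}

theorem revExp_insert {A : Finset (Fin n)} {i : Fin n} (hi : i ∉ A)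
    (φ : Finset (Fin n) → ℝ) :
    revExp p (insert i A) φ
      = (1 - p i) * revExp p A φ + p i * revExp p A fun R => φ (insert i R) := by
  unfold revExp
  rw [sum_powerset_insert hi, mul_sum, mul_sum]
  congr 1
  · refine sum_congr rfl fun R hR => ?_
    have hR' := mem_powerset.1 hR
    have h : i ∉ R := fun h => hi (hR' h)
    rw [insert_sdiff_of_notMem _ h, prod_insert (by simp [hi])]
    ring
  · refine sum_congr rfl fun R hR => ?_
    have hR' := mem_powerset.1 hR
    have h : i ∉ R := fun h => hi (hR' h)
    rw [prod_insert h, insert_sdiff_insert, sdiff_insert_of_notMem hi]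
    ring

theorem revExp_add (A : Finset (Fin n)) (φ ψ : Finset (Fin n) → ℝ) :
    revExp p A (fun R => φ R + ψ R) = revExp p A φ + revExp p A ψ := by
  simp [revExp, mul_add, sum_add_distrib]

theorem revExp_sub (A : Finset (Fin n)) (φ ψ : Finset (Fin n) → ℝ) :
    revExp p A (fun R => φ R - ψ R) = revExp p A φ - revExp p A ψ := by
  simp [revExp, mul_sub, sum_sub_distrib]

theorem revExp_const_mul (A : Finset (Fin n)) (r : ℝ) (φ : Finset (Fin n) → ℝ) :
    revExp p A (fun R => r * φ R) = r * revExp p A φ := by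
  simp only [revExp, mul_sum]
  exact sum_congr rfl fun R _ => by ring

theorem revExp_sum {ι : Type*} (A : Finset (Fin n)) (s : Finset ι)
    (φ : ι → Finset (Fin n) → ℝ) :
    revExp p A (fun R => ∑ j ∈ s, φ j R) = ∑ j ∈ s, revExp p A (φ j) := by
  simp only [revExp, mul_sum]
  exact sum_comm

theorem revExp_const (A : Finset (Fin n)) (r : ℝ) : revExp p A (fun _ => r) = r := by
  induction A using Finset.induction_on with
  | empty => simp [revExp]
  | insert i A hi ih => rw [revExp_insert hi, ih]; ring

theorem revExp_congr {A : Finset (Fin n)} {φ ψ : Finset (Fin n) → ℝ}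
    (h : ∀ R ⊆ A, φ R = ψ R) : revExp p A φ = revExp p A ψ :=
  sum_congr rfl fun R hR => by rw [h R (mem_powerset.1 hR)]

theorem revExp_mono (hp : ∀ i, 0 < p i ∧ p i ≤ 1) {A : Finset (Fin n)}
    {φ ψ : Finset (Fin n) → ℝ} (h : ∀ R ⊆ A, φ R ≤ ψ R) : revExp p A φ ≤ revExp p A ψ := by
  refine sum_le_sum fun R hR => mul_le_mul_of_nonneg_left (h R (mem_powerset.1 hR)) ?_
  exact mul_nonneg (prod_nonneg fun i _ => (hp i).1.le)
    (prod_nonneg fun i _ => sub_nonneg.2 (hp i).2)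

theorem revExp_sum_mem (A : Finset (Fin n)) (a : Fin n → ℝ) :
    revExp p A (fun R => ∑ j ∈ R, a j) = ∑ j ∈ A, p j * a j := by
  induction A using Finset.induction_on with
  | empty => simp [revExp]
  | insert i A hi ih =>
    have h : revExp p A (fun R => ∑ j ∈ insert i R, a j)
        = revExp p A (fun R => a i + ∑ j ∈ R, a j) :=
      revExp_congr fun R hR => sum_insert fun h => hi (hR h)
    rw [revExp_insert hi, h, revExp_add, revExp_const, ih, sum_insert hi]
    ring

theorem revExp_one (A : Finset (Fin n)) (φ : Finset (Fin n) → ℝ) :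
    revExp (fun _ => 1) A φ = φ A := by
  unfold revExp
  rw [sum_eq_single A]
  · simp
  · intro R hR hne
    have h : (A \ R).Nonempty := by
      rw [sdiff_nonempty]
      exact fun h => hne ((mem_powerset.1 hR).antisymm h)
    simp [h.card_pos.ne']
  · simp

end revExp

section avgScore

variable {n : ℕ}

theorem sigProb_mul_postProb (p : Fin n → ℝ) (Ψ : Finset (Fin n)) (σ : Sig n) (ω : St n) :
    sigProb p Ψ σ * postProb σ ω
      = (1 / 2) ^ n * revExp p Ψ fun R => if σ = reveal R ω then 1 else 0 := by
  have h1 : sigProb p Ψ σ * postProb σ ω = ∏ i, ((1 / 2 : ℝ) *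
      if i ∈ Ψ then p i * (if σ i = some (ω i) then 1 else 0)
        + (1 - p i) * (if σ i = none then 1 else 0)
      else if σ i = none then 1 else 0) := by
    unfold sigProb postProb
    rw [← prod_mul_distrib]
    refine prod_congr rfl fun i _ => ?_
    rcases hs : σ i with _ | b
    · simp; split_ifs <;> ring
    · by_cases hb : ω i = b
      · simp [hb]; split_ifs <;> ring
      · have hb' : ¬ b = ω i := fun h => hb h.symm
        simp [hb, hb']
  rw [h1, prod_mul_distrib, prod_const, card_univ, Fintype.card_fin]
  congr 1
  rw [prod_ite, filter_mem_eq_inter, univ_inter, prod_add, sum_mul]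
  refine sum_congr rfl fun R hR => ?_
  have hR' := mem_powerset.1 hR
  rw [prod_mul_distrib, prod_mul_distrib, prod_boole, prod_boole, prod_boole]
  have key : σ = reveal R ω ↔ (∀ i ∈ R, σ i = some (ω i)) ∧ (∀ i ∈ Ψ \ R, σ i = none) ∧
      ∀ i ∈ univ.filter (fun i => i ∉ Ψ), σ i = none := by
    constructor
    · rintro rfl
      refine ⟨fun i hi => by simp [reveal, hi], fun i hi => ?_, fun i hi => ?_⟩
      · simp [reveal, (mem_sdiff.1 hi).2]
      · have : i ∉ R := fun h => (mem_filter.1 hi).2 (hR' h)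
        simp [reveal, this]
    · rintro ⟨h1, h2, h3⟩
      funext i
      by_cases hi : i ∈ R
      · simp [reveal, hi, h1 i hi]
      · by_cases hΨ : i ∈ Ψ
        · simp [reveal, hi, h2 i (mem_sdiff.2 ⟨hΨ, hi⟩)]
        · simp [reveal, hi, h3 i (by simp [hΨ])]
  simp only [key, ite_and]
  split_ifs <;> simp

theorem expScore_eq_revExp (p : Fin n → ℝ) (Ψ : Finset (Fin n)) (S : Sig n → St n → ℝ) :
    expScore p Ψ S = revExp p Ψ (avgScore S) := by
  have h : expScore p Ψ S
      = ∑ ω : St n, ∑ σ : Sig n, sigProb p Ψ σ * postProb σ ω * S σ ω := by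
    unfold expScore postExp
    rw [sum_comm]
    refine sum_congr rfl fun σ _ => ?_
    rw [mul_sum]
    exact sum_congr rfl fun ω _ => by ring
  have h' : ∀ ω : St n, ∑ σ : Sig n, sigProb p Ψ σ * postProb σ ω * S σ ω
      = revExp p Ψ fun R => (1 / 2) ^ n * S (reveal R ω) ω := by
    intro ω
    have h2 : ∀ σ : Sig n, sigProb p Ψ σ * postProb σ ω * S σ ω
        = revExp p Ψ fun R => (1 / 2) ^ n * S σ ω * if σ = reveal R ω then 1 else 0 := by
      intro σ
      rw [sigProb_mul_postProb, revExp_const_mul]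
      ring
    simp_rw [h2]
    rw [← revExp_sum]
    refine revExp_congr fun R _ => ?_
    simp
  rw [h, sum_congr rfl fun ω _ => h' ω, ← revExp_sum]
  refine revExp_congr fun R _ => ?_
  rw [avgScore, mul_sum]

theorem avgScore_eq_expScore (S : Sig n → St n → ℝ) (R : Finset (Fin n)) :
    avgScore S R = expScore (fun _ => 1) R S := by
  rw [expScore_eq_revExp, revExp_one]

theorem Proper.avgScore_le {S : Sig n → St n → ℝ} (hS : Proper S) (D : Sig n → Sig n)
    (R : Finset (Fin n)) : avgScore (fun σ => S (D σ)) R ≤ avgScore S R := by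
  rw [avgScore_eq_expScore, avgScore_eq_expScore]
  refine sum_le_sum fun σ _ => mul_le_mul_of_nonneg_left (hS σ (D σ)) ?_
  refine prod_nonneg fun i _ => ?_
  rcases σ i with _ | b <;> simp <;> split_ifs <;> norm_num

theorem Proper.avgScore_insert_le {S : Sig n → St n → ℝ} (hS : Proper S)
    (h0 : ∀ σ ω, S σ ω ∈ Set.Icc (0 : ℝ) 1) (i : Fin n) (R : Finset (Fin n)) :
    avgScore S (insert i R) ≤ 2 * avgScore S R := by
  have hb := fun b : Bool => hS.avgScore_le (fun σ => Function.update σ i (some b)) R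
  have h : avgScore S (insert i R)
      ≤ avgScore (fun σ => S (Function.update σ i (some true))) R
        + avgScore (fun σ => S (Function.update σ i (some false))) R := by
    unfold avgScore
    rw [← mul_add, ← sum_add_distrib]
    refine mul_le_mul_of_nonneg_left (sum_le_sum fun ω _ => ?_) (by positivity)
    have hr : reveal (insert i R) ω = Function.update (reveal R ω) i (some (ω i)) := by
      funext k
      by_cases hk : k = i
      · subst hk; simp [reveal]
      · simp [reveal, hk]
    rw [hr]
    have ht := (h0 (Function.update (reveal R ω) i (some true)) ω).1
    have hf := (h0 (Function.update (reveal R ω) i (some false)) ω).1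
    cases ω i <;> simp [ht, hf]
  linarith [hb true, hb false]

theorem avgScore_mem_Icc {S : Sig n → St n → ℝ}
    (h0 : ∀ σ ω, S σ ω ∈ Set.Icc (0 : ℝ) 1) (R : Finset (Fin n)) :
    avgScore S R ∈ Set.Icc (0 : ℝ) 1 := by
  refine ⟨mul_nonneg (by positivity) (sum_nonneg fun ω _ => (h0 _ ω).1), ?_⟩
  calc avgScore S R ≤ (1 / 2) ^ n * ∑ _ω : St n, (1 : ℝ) :=
        mul_le_mul_of_nonneg_left (sum_le_sum fun ω _ => (h0 _ ω).2) (by positivity)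
    _ = 1 := by simp

end avgScore

section truncated

variable {n : ℕ}

/-- Score for a single task: `a` for a correct report, `-a` for a wrong one and `0` for
an uninformative one. -/
def taskScore (a : ℝ) : Option Bool → Bool → ℝ
  | none, _ => 0
  | some b, w => if w = b then a else -a

/-- The truncated separate scoring rule with budget `1` and shift `-1/2` built from
`taskScore`. -/
noncomputable def truncScore (a : Fin n → ℝ) (σ : Sig n) (ω : St n) : ℝ :=
  min 1 (max 0 (-(-(1 / 2)) + ∑ i, taskScore (a i) (σ i) (ω i)))

theorem truncScore_mem_Icc (a : Fin n → ℝ) (σ : Sig n) (ω : St n) :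
    truncScore a σ ω ∈ Set.Icc (0 : ℝ) 1 :=
  ⟨le_min zero_le_one (le_max_left _ _), min_le_left _ _⟩

theorem isTruncSep_truncScore (a : Fin n → ℝ) : IsTruncSep 1 (truncScore a) :=
  ⟨fun i => taskScore (a i), -(1 / 2), fun _ _ => rfl⟩

theorem clamp_add_clamp_le {x y t : ℝ} (ht : 0 ≤ t) (h : x + y ≤ 2 * t) :
    min 1 (max 0 (-(-(1 / 2)) + x)) + min 1 (max 0 (-(-(1 / 2)) + y))
      ≤ 2 * min 1 (max 0 (-(-(1 / 2)) + t)) := by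
  rw [max_eq_right (by linarith : (0 : ℝ) ≤ -(-(1 / 2)) + t)]
  rcases min_cases 1 (max 0 (-(-(1 / 2)) + x)) with h1 | h1 <;>
  rcases min_cases 1 (max 0 (-(-(1 / 2)) + y)) with h2 | h2 <;>
  rcases min_cases 1 (-(-(1 / 2)) + t) with h3 | h3 <;>
  rcases max_cases 0 (-(-(1 / 2)) + x) with h4 | h4 <;>
  rcases max_cases 0 (-(-(1 / 2)) + y) with h5 | h5 <;>
  linarith

/-- The state profile obtained from `ω` by flipping the states not revealed by `σ`. -/
def flipHidden (σ : Sig n) (ω : St n) : St n :=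
  fun i => if σ i = none then !ω i else ω i

theorem flipHidden_involutive (σ : Sig n) : Function.Involutive (flipHidden σ) := by
  intro ω
  funext i
  by_cases h : σ i = none <;> simp [flipHidden, h]

theorem postProb_flipHidden (σ : Sig n) (ω : St n) :
    postProb σ (flipHidden σ ω) = postProb σ ω := by
  refine prod_congr rfl fun i _ => ?_
  rcases h : σ i with _ | b <;> simp [flipHidden, h]

theorem postProb_nonneg (σ : Sig n) (ω : St n) : 0 ≤ postProb σ ω := by
  refine prod_nonneg fun i _ => ?_
  rcases σ i with _ | b
  · simp
  · simp only [Option.elim]; split_ifs <;> norm_num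

theorem postExp_flipHidden (σ : Sig n) (f : St n → ℝ) :
    postExp σ (fun ω => f (flipHidden σ ω)) = postExp σ f := by
  unfold postExp
  rw [← Equiv.sum_comp (flipHidden_involutive σ).toPerm fun ω => postProb σ ω * f ω]
  simp [postProb_flipHidden]

theorem eq_of_postProb_ne_zero {σ : Sig n} {ω : St n} (h : postProb σ ω ≠ 0) {i : Fin n}
    {b : Bool} (hb : σ i = some b) : ω i = b := by
  by_contra hne
  exact h (prod_eq_zero (mem_univ i) (by simp [hb, hne]))

theorem truncScore_proper {a : Fin n → ℝ} (ha : ∀ i, 0 ≤ a i) : Proper (truncScore a) := by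
  intro σ σ'
  have key : postExp σ (truncScore a σ')
      + postExp σ (fun ω => truncScore a σ' (flipHidden σ ω))
      ≤ 2 * postExp σ (truncScore a σ) := by
    unfold postExp
    rw [← sum_add_distrib, mul_sum]
    refine sum_le_sum fun ω _ => ?_
    rw [← mul_add, mul_left_comm]
    by_cases h0 : postProb σ ω = 0
    · simp [h0]
    refine mul_le_mul_of_nonneg_left (clamp_add_clamp_le ?_ ?_) (postProb_nonneg σ ω)
    · refine sum_nonneg fun i _ => ?_
      rcases h : σ i with _ | b
      · simp [taskScore]
      · simp [taskScore, eq_of_postProb_ne_zero h0 h, ha i]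
    · rw [← sum_add_distrib, mul_sum]
      refine sum_le_sum fun i _ => ?_
      have hai := ha i
      rcases h : σ i with _ | b
      · rcases σ' i with _ | b'
        · simp [taskScore]
        · cases b' <;> rcases hω : ω i with _ | _ <;> simp [taskScore, flipHidden, h, hω]
      · have hω := eq_of_postProb_ne_zero h0 h
        rcases σ' i with _ | b'
        · simp [taskScore, hω, hai]
        · simp only [taskScore, flipHidden, h, hω]
          simp only [reduceCtorEq, if_false, if_true]
          split_ifs <;> linarith
  rw [postExp_flipHidden] at key
  linarith

theorem avgScore_truncScore {a : Fin n → ℝ} (ha : ∀ i, 0 ≤ a i) (R : Finset (Fin n)) :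
    avgScore (truncScore a) R = min 1 (1 / 2 + ∑ i ∈ R, a i) := by
  have h : ∀ ω : St n, truncScore a (reveal R ω) ω = min 1 (1 / 2 + ∑ i ∈ R, a i) := by
    intro ω
    have hs : ∑ i, taskScore (a i) (reveal R ω i) (ω i) = ∑ i ∈ R, a i := by
      rw [← univ_inter R, ← sum_ite_mem]
      refine sum_congr rfl fun i _ => ?_
      by_cases hi : i ∈ R <;> simp [reveal, hi, taskScore]
    have h0 : 0 ≤ ∑ i ∈ R, a i := sum_nonneg fun i _ => ha i
    rw [truncScore, hs, neg_neg, max_eq_right (by linarith)]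
  simp [avgScore, h]

theorem mul_one_sub_le_min_sub_min {a y : ℝ} (ha : 0 ≤ a) (ha' : a ≤ 1 / 2) (hy : 0 ≤ y) :
    a * (1 - 2 * y) ≤ min 1 (1 / 2 + (a + y)) - min 1 (1 / 2 + y) := by
  rcases min_cases 1 (1 / 2 + (a + y)) with h1 | h1 <;>
  rcases min_cases 1 (1 / 2 + y) with h2 | h2 <;> nlinarith

/-- `Ψ` can be incentivized by a truncated separate scoring rule with scores in `[0,1]`. -/
def Implementable (p c : Fin n → ℝ) (Ψ : Finset (Fin n)) : Prop :=
  ∃ S : Sig n → St n → ℝ, (∀ σ ω, S σ ω ∈ Set.Icc (0 : ℝ) 1) ∧ IC p c S Ψ ∧ IsTruncSep 1 S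

variable {p c : Fin n → ℝ}

theorem implementable_of_le (hp : ∀ i, 0 < p i ∧ p i ≤ 1) (hc : ∀ i, 0 < c i)
    {Ψ : Finset (Fin n)} {a : Fin n → ℝ} (ha : ∀ i, 0 ≤ a i) (ha' : ∀ i ∈ Ψ, a i ≤ 1 / 2)
    (h : ∀ i ∈ Ψ, c i ≤ p i * (a i * (1 - 2 * ∑ j ∈ Ψ.erase i, p j * a j))) :
    Implementable p c Ψ := by
  set b : Fin n → ℝ := fun i => if i ∈ Ψ then a i else 0 with hb
  have hb0 : ∀ i, 0 ≤ b i := fun i => by simp only [hb]; split_ifs <;> simp [ha]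
  have hbΨ : ∀ i ∈ Ψ, b i = a i := fun i hi => by simp [hb, hi]
  have hg : avgScore (truncScore b) = fun R => min 1 (1 / 2 + ∑ i ∈ R, b i) :=
    funext (avgScore_truncScore hb0)
  refine ⟨truncScore b, truncScore_mem_Icc b, ⟨truncScore_proper hb0, fun Ψ' => ?_⟩,
    isTruncSep_truncScore b⟩
  simp only [expScore_eq_revExp, hg]
  have hins : ∀ i (A : Finset (Fin n)), i ∉ A →
      revExp p (insert i A) (fun R => min 1 (1 / 2 + ∑ i ∈ R, b i))
        - revExp p A (fun R => min 1 (1 / 2 + ∑ i ∈ R, b i))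
      = p i * revExp p A fun R => min 1 (1 / 2 + (b i + ∑ i ∈ R, b i))
          - min 1 (1 / 2 + ∑ i ∈ R, b i) := by
    intro i A hi
    rw [revExp_insert hi, revExp_sub]
    have : revExp p A (fun R => min 1 (1 / 2 + ∑ i ∈ insert i R, b i))
        = revExp p A (fun R => min 1 (1 / 2 + (b i + ∑ i ∈ R, b i))) :=
      revExp_congr fun R hR => by rw [sum_insert fun h => hi (hR h)]
    rw [this]
    ring
  have hdrop : ∀ D A : Finset (Fin n), Disjoint D A → Disjoint D Ψ →
      revExp p (D ∪ A) (fun R => min 1 (1 / 2 + ∑ i ∈ R, b i)) - ∑ i ∈ D ∪ A, c i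
        ≤ revExp p A (fun R => min 1 (1 / 2 + ∑ i ∈ R, b i)) - ∑ i ∈ A, c i := by
    intro D A
    induction D using Finset.induction_on with
    | empty => simp
    | insert i D hi ih =>
      intro hd hs
      rw [disjoint_insert_left] at hd hs
      have hni : i ∉ D ∪ A := by simp [hi, hd.1]
      have h1 := ih hd.2 hs.2
      have h2 := hins i (D ∪ A) hni
      have hbi : b i = 0 := by simp [hb, hs.1]
      simp only [hbi, zero_add, sub_self, revExp_const, mul_zero] at h2
      rw [insert_union, sum_insert hni]
      linarith [hc i]
  have hgrow : ∀ D A : Finset (Fin n), Disjoint D A → D ∪ A ⊆ Ψ →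
      revExp p A (fun R => min 1 (1 / 2 + ∑ i ∈ R, b i)) - ∑ i ∈ A, c i
        ≤ revExp p (D ∪ A) (fun R => min 1 (1 / 2 + ∑ i ∈ R, b i)) - ∑ i ∈ D ∪ A, c i := by
    intro D A
    induction D using Finset.induction_on with
    | empty => simp
    | insert i D hi ih =>
      intro hd hs
      rw [disjoint_insert_left] at hd
      rw [insert_union] at hs ⊢
      have hiΨ := hs (mem_insert_self _ _)
      have hs' := (subset_insert _ _).trans hs
      have hni : i ∉ D ∪ A := by simp [hi, hd.1]
      have h1 := ih hd.2 hs'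
      have h2 := hins i (D ∪ A) hni
      rw [sum_insert hni]
      have h3 : b i * (1 - 2 * ∑ j ∈ D ∪ A, p j * b j)
          ≤ revExp p (D ∪ A) fun R => min 1 (1 / 2 + (b i + ∑ i ∈ R, b i))
            - min 1 (1 / 2 + ∑ i ∈ R, b i) := by
        rw [← revExp_sum_mem, ← revExp_const_mul,
          ← revExp_const (p := p) (D ∪ A) 1, ← revExp_sub, ← revExp_const_mul]
        refine revExp_mono hp fun R _ => ?_
        rw [revExp_const]
        exact mul_one_sub_le_min_sub_min (hb0 i) (by rw [hbΨ i hiΨ]; exact ha' i hiΨ)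
          (sum_nonneg fun j _ => hb0 j)
      have h4 : ∑ j ∈ D ∪ A, p j * b j ≤ ∑ j ∈ Ψ.erase i, p j * a j := by
        rw [sum_congr rfl fun j hj => by rw [hbΨ j (hs' hj)]]
        exact sum_le_sum_of_subset_of_nonneg
          (fun j hj => mem_erase.2 ⟨fun h => hni (h ▸ hj), hs' hj⟩)
          fun j _ _ => mul_nonneg (hp j).1.le (ha j)
      have h5 : c i ≤ p i * (b i * (1 - 2 * ∑ j ∈ D ∪ A, p j * b j)) := by
        refine (h i hiΨ).trans (mul_le_mul_of_nonneg_left ?_ (hp i).1.le)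
        rw [hbΨ i hiΨ]
        exact mul_le_mul_of_nonneg_left (by linarith) (ha i)
      have h6 := mul_le_mul_of_nonneg_left h3 (hp i).1.le
      linarith
  have h1 := hdrop (Ψ' \ Ψ) (Ψ' ∩ Ψ)
    (sdiff_disjoint.mono_right inter_subset_right) sdiff_disjoint
  rw [sdiff_union_inter] at h1
  have h2 := hgrow (Ψ \ (Ψ' ∩ Ψ)) (Ψ' ∩ Ψ) sdiff_disjoint
    (by rw [sdiff_union_of_subset inter_subset_right])
  rw [sdiff_union_of_subset inter_subset_right] at h2
  linarith

end truncated

section upperBound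

variable {n : ℕ} {p c : Fin n → ℝ}

theorem implementable_of_sum_le_eighth (hp : ∀ i, 0 < p i ∧ p i ≤ 1) (hc : ∀ i, 0 < c i)
    {Ψ : Finset (Fin n)} (h4 : ∀ i ∈ Ψ, 4 * c i ≤ p i) (hs : ∑ i ∈ Ψ, c i ≤ 1 / 8) :
    Implementable p c Ψ := by
  refine implementable_of_le hp hc (a := fun i => 2 * c i / p i)
    (fun i => div_nonneg (by linarith [hc i]) (hp i).1.le) (fun i hi => ?_) (fun i hi => ?_)
  · rw [div_le_iff₀ (hp i).1]
    linarith [h4 i hi]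
  · have hmul : ∀ j, p j * (2 * c j / p j) = 2 * c j := fun j =>
      mul_div_cancel₀ _ (hp j).1.ne'
    rw [← mul_assoc, hmul, sum_congr rfl fun j _ => hmul j, ← mul_sum]
    have hle : ∑ j ∈ Ψ.erase i, c j ≤ ∑ j ∈ Ψ, c j :=
      sum_le_sum_of_subset_of_nonneg (erase_subset _ _) fun j _ _ => (hc j).le
    nlinarith [hc i]

theorem implementable_of_sum_le (hp : ∀ i, 0 < p i ∧ p i ≤ 1) (hc : ∀ i, 0 < c i)
    {Ψ : Finset (Fin n)} {e : ℝ} (he : ∀ i ∈ Ψ, p i * e ≤ p i - 2 * c i)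
    (hs : ∑ i ∈ Ψ, p i ≤ e) : Implementable p c Ψ := by
  refine implementable_of_le hp hc (a := fun _ => 1 / 2) (fun _ => by norm_num)
    (fun _ _ => le_rfl) (fun i hi => ?_)
  rw [← sum_mul]
  have hle : ∑ j ∈ Ψ.erase i, p j ≤ ∑ j ∈ Ψ, p j :=
    sum_le_sum_of_subset_of_nonneg (erase_subset _ _) fun j _ _ => (hp j).1.le
  nlinarith [he i hi, mul_le_mul_of_nonneg_left (hle.trans hs) (hp i).1.le]

theorem implementable_singleton (hp : ∀ i, 0 < p i ∧ p i ≤ 1) (hc : ∀ i, 0 < c i)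
    {i : Fin n} (h : 2 * c i ≤ p i) : Implementable p c {i} := by
  refine implementable_of_le hp hc (a := fun _ => 1 / 2) (fun _ => by norm_num)
    (fun _ _ => le_rfl) (fun j hj => ?_)
  rw [mem_singleton.1 hj]
  simp
  linarith

theorem implementable_empty (hp : ∀ i, 0 < p i ∧ p i ≤ 1) (hc : ∀ i, 0 < c i) :
    Implementable p c ∅ :=
  implementable_of_sum_le hp hc (e := 0) (by simp) (by simp)

theorem IC.sum_cost_le_one {S : Sig n → St n → ℝ} {Ψ : Finset (Fin n)}
    (hp : ∀ i, 0 < p i ∧ p i ≤ 1) (h0 : ∀ σ ω, S σ ω ∈ Set.Icc (0 : ℝ) 1)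
    (hS : IC p c S Ψ) : ∑ i ∈ Ψ, c i ≤ 1 := by
  have h := hS.2 ∅
  simp only [expScore_eq_revExp, sum_empty, sub_zero] at h
  have h1 := revExp_mono hp (A := Ψ) fun R _ => (avgScore_mem_Icc h0 R).2
  have h2 := revExp_mono hp (A := ∅) fun R _ => (avgScore_mem_Icc h0 R).1
  rw [revExp_const] at h1 h2
  linarith

theorem IC.cost_le {S : Sig n → St n → ℝ} {Ψ : Finset (Fin n)} (hS : IC p c S Ψ)
    {i : Fin n} (hi : i ∈ Ψ) :
    c i ≤ p i * revExp p (Ψ.erase i) fun R => avgScore S (insert i R) - avgScore S R := by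
  have h := hS.2 (Ψ.erase i)
  rw [expScore_eq_revExp, expScore_eq_revExp, ← add_sum_erase _ _ hi] at h
  nth_rewrite 1 [← insert_erase hi] at h
  rw [revExp_insert (notMem_erase i Ψ)] at h
  rw [revExp_sub]
  linarith

/-- If some task needs nearly the largest possible score increment `1 / 2`, then the tasks
needing an increment of at least `1 / 4` have a small total revelation probability. -/
theorem sum_le_of_revExp_increment (hp : ∀ i, 0 < p i ∧ p i ≤ 1)
    {g : Finset (Fin n) → ℝ} (hg1 : ∀ R, g R ≤ 1)
    (hg2 : ∀ i R, g (insert i R) ≤ 2 * g R) {Ψ H : Finset (Fin n)} {i : Fin n} {δ : ℝ}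
    (hi : i ∈ Ψ) (hδ : δ ≤ 1 / 96)
    (hδi : 1 / 2 - δ ≤ revExp p (Ψ.erase i) fun R => g (insert i R) - g R)
    (hH : H ⊆ Ψ.erase i) (hpH : ∀ j ∈ H, p j ≤ 1 / 12)
    (hinc : ∀ j ∈ H, 1 / 4 ≤ revExp p (Ψ.erase j) fun R => g (insert j R) - g R)
    (hs : ∑ j ∈ H, p j ≤ 1 / 4) : ∑ j ∈ H, p j ≤ 16 * δ := by
  classical
  set W := Ψ.erase i with hW
  have habs : ∀ R, |g R - 1 / 2| ≤ 1 / 2 - (g (insert i R) - g R) := fun R =>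
    abs_le.2 ⟨by linarith [hg2 i R], by linarith [hg1 (insert i R)]⟩
  have hY : revExp p W (fun R => 1 / 2 - (g (insert i R) - g R)) ≤ δ := by
    rw [revExp_sub, revExp_const]; linarith
  have hX : revExp p W (fun R => |g R - 1 / 2|) ≤ δ :=
    (revExp_mono hp fun R _ => habs R).trans hY
  have hY0 : ∀ R, 0 ≤ 1 / 2 - (g (insert i R) - g R) := fun R =>
    (abs_nonneg _).trans (habs R)
  have hδ0 : 0 ≤ δ := by
    have := revExp_mono hp (A := W) fun R _ => abs_nonneg (g R - 1 / 2)
    rw [revExp_const] at this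
    linarith
  have key : ∀ j ∈ H, p j * (1 / 16) ≤ revExp p W fun R =>
      if j ∈ R ∧ Disjoint (R.erase j) H then |g R - 1 / 2| else 0 := by
    intro j hj
    have hjW := hH hj
    have hij : j ≠ i := ne_of_mem_erase hjW
    have hiV : i ∉ W.erase j := fun h => notMem_erase i Ψ (erase_subset _ _ h)
    have hjV : j ∉ W.erase j := notMem_erase j W
    have hWV : W = insert j (W.erase j) := (insert_erase hjW).symm
    have hΨV : Ψ.erase j = insert i (W.erase j) := by
      rw [hW, erase_right_comm, insert_erase (mem_erase.2 ⟨hij.symm, hi⟩)]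
    set V := W.erase j with hV
    have hYV : revExp p V (fun R => 1 / 2 - (g (insert i R) - g R)) ≤ 2 * δ := by
      rw [hWV, revExp_insert hjV] at hY
      have h1 := revExp_mono hp (A := V) fun R _ => hY0 (insert j R)
      have h2 := revExp_mono hp (A := V) fun R _ => hY0 R
      rw [revExp_const] at h1 h2
      nlinarith [hp j, hpH j hj, mul_nonneg (hp j).1.le h1]
    have hXV : revExp p V (fun R => |g R - 1 / 2|) ≤ 2 * δ :=
      (revExp_mono hp fun R _ => habs R).trans hYV
    have hinV : 1 / 4 - 4 * δ ≤ revExp p V fun R => g (insert j R) - g R := by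
      have h1 := hinc j hj
      rw [hΨV, revExp_insert hiV] at h1
      have h2 : revExp p V (fun R => g (insert j (insert i R)) - g (insert i R)) ≤ 4 * δ := by
        calc _ ≤ revExp p V fun R => 2 * (1 / 2 - (g (insert i R) - g R)) :=
              revExp_mono hp fun R _ => by
                linarith [hg1 (insert j (insert i R)), hg2 i R, hg1 (insert i R)]
          _ ≤ 4 * δ := by rw [revExp_const_mul]; linarith
      by_contra! hlt
      have h3 := mul_le_mul_of_nonneg_left h2 (hp i).1.le
      rcases (hp i).2.eq_or_lt with h | h
      · rw [h] at h1 h3; linarith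
      · have h4 := mul_lt_mul_of_pos_left hlt (sub_pos.2 h)
        nlinarith [(hp i).1]
    have hdisj : revExp p V (fun R => ∑ k ∈ R, if k ∈ H then (1 : ℝ) else 0) ≤ 1 / 4 := by
      rw [revExp_sum_mem]
      refine le_trans ?_ hs
      simp only [mul_ite, mul_one, mul_zero]
      rw [← sum_filter]
      exact sum_le_sum_of_subset_of_nonneg (fun k hk => (mem_filter.1 hk).2)
        fun k _ _ => (hp k).1.le
    rw [hWV, revExp_insert hjV]
    have hzero : revExp p V (fun R =>
        if j ∈ R ∧ Disjoint (R.erase j) H then |g R - 1 / 2| else 0) = 0 := by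
      refine Eq.trans (revExp_congr fun R hR => if_neg ?_) (revExp_const V 0)
      exact fun h => hjV (hR h.1)
    rw [hzero, mul_zero, zero_add]
    refine mul_le_mul_of_nonneg_left ?_ (hp j).1.le
    calc (1 : ℝ) / 16 ≤ revExp p V (fun R => g (insert j R) - g R)
          - revExp p V (fun R => |g R - 1 / 2|)
          - 1 / 2 * revExp p V (fun R => ∑ k ∈ R, if k ∈ H then (1 : ℝ) else 0) := by linarith
      _ = revExp p V fun R => g (insert j R) - g R - |g R - 1 / 2|
          - 1 / 2 * ∑ k ∈ R, if k ∈ H then (1 : ℝ) else 0 := by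
        simp only [revExp_sub, revExp_const_mul]
      _ ≤ _ := revExp_mono hp fun R hR => by
        have hjR : j ∉ R := fun h => hjV (hR h)
        have h0 : ∀ k ∈ R, (0 : ℝ) ≤ if k ∈ H then 1 else 0 := fun k _ => by
          split_ifs <;> norm_num
        rw [erase_insert hjR]
        by_cases hD : Disjoint R H
        · rw [if_pos ⟨mem_insert_self _ _, hD⟩]
          have h1 := sum_nonneg h0
          linarith [neg_abs_le (g R - 1 / 2), le_abs_self (g (insert j R) - 1 / 2)]
        · rw [if_neg fun h => hD h.2]
          obtain ⟨k, hkR, hkH⟩ := not_disjoint_iff.1 hD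
          have h1 := single_le_sum h0 hkR
          rw [if_pos hkH] at h1
          linarith [abs_nonneg (g R - 1 / 2), hg2 j R, hg1 (insert j R)]
  have hfin : ∑ j ∈ H, p j * (1 / 16) ≤ revExp p W fun R => |g R - 1 / 2| := by
    refine (sum_le_sum key).trans ?_
    rw [← revExp_sum]
    refine revExp_mono hp fun R _ => ?_
    by_cases hex : ∃ j ∈ H, j ∈ R ∧ Disjoint (R.erase j) H
    · obtain ⟨j, hjH, hjR, hjD⟩ := hex
      rw [sum_eq_single_of_mem j hjH, if_pos ⟨hjR, hjD⟩]
      intro k hkH hkj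
      exact if_neg fun h => disjoint_left.1 hjD (mem_erase.2 ⟨hkj, h.1⟩) hkH
    · rw [sum_eq_zero fun j hj => if_neg fun h => hex ⟨j, hj, h⟩]
      exact abs_nonneg _
  rw [← sum_mul] at hfin
  linarith

theorem sum_le_of_forall_subset {w : Fin n → ℝ} {K t : ℝ} {H : Finset (Fin n)}
    (hK : 0 ≤ K) (hstep : ∀ j ∈ H, K + w j ≤ t)
    (h : ∀ H' ⊆ H, ∑ j ∈ H', w j ≤ t → ∑ j ∈ H', w j ≤ K) : ∑ j ∈ H, w j ≤ K := by
  induction H using Finset.induction_on with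
  | empty => simpa
  | insert i H hi ih =>
    have h1 := ih (fun j hj => hstep j (mem_insert_of_mem hj))
      fun H' hH' => h H' (hH'.trans (subset_insert _ _))
    refine h _ subset_rfl ?_
    rw [sum_insert hi]
    linarith [hstep i (mem_insert_self _ _)]

/-- A set of total weight `W` splits into at most `1 + 2 * W / C` sets that are singletons or
have weight at most `C`. -/
theorem mul_sum_le_of_pack {w v : Fin n → ℝ} (hw : ∀ i, 0 ≤ w i) {C M : ℝ} (hC : 0 < C)
    (hM : 0 ≤ M) {A : Finset (Fin n)} (hsing : ∀ i ∈ A, v i ≤ M)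
    (hpack : ∀ B ⊆ A, ∑ i ∈ B, w i ≤ C → ∑ i ∈ B, v i ≤ M) :
    C * ∑ i ∈ A, v i ≤ M * (C + 2 * ∑ i ∈ A, w i) := by
  induction A using Finset.strongInduction with
  | H A ih =>
    have hw0 : 0 ≤ ∑ i ∈ A, w i := sum_nonneg fun i _ => hw i
    by_cases hA : ∑ i ∈ A, w i ≤ C
    · nlinarith [hpack A subset_rfl hA, mul_nonneg hM hw0]
    · obtain ⟨B, hB, hmax⟩ := (A.powerset.filter fun B => ∑ i ∈ B, w i ≤ C).exists_max_image
        card ⟨∅, by simp [hC.le]⟩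
      obtain ⟨hBA, hBC⟩ := mem_filter.1 hB
      rw [mem_powerset] at hBA
      obtain ⟨j, hjA, hjB⟩ : ∃ j ∈ A, j ∉ B := by
        by_contra! hcon
        exact hA (hBA.antisymm hcon ▸ hBC)
      have hins : insert j B ⊆ A := insert_subset hjA hBA
      have hgt : C < ∑ i ∈ insert j B, w i := by
        by_contra! hle
        have := hmax (insert j B) (mem_filter.2 ⟨mem_powerset.2 hins, hle⟩)
        rw [card_insert_of_notMem hjB] at this
        omega
      have hrec := ih (A \ insert j B)
        (sdiff_ssubset hins (insert_nonempty j B))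
        (fun i hi => hsing i (sdiff_subset hi)) fun B' hB' => hpack B' (hB'.trans sdiff_subset)
      have hv := sum_sdiff (f := v) hins
      have hw' := sum_sdiff (f := w) hins
      rw [sum_insert hjB] at hv
      have h1 := hsing j hjA
      have h2 := hpack B hBA hBC
      rw [← hv, ← hw']
      nlinarith [mul_le_mul_of_nonneg_left (add_le_add h1 h2) hC.le,
        mul_le_mul_of_nonneg_left hgt.le hM]

theorem IC.sum_value_le {S : Sig n → St n → ℝ} {Ψ : Finset (Fin n)} {v : Fin n → ℝ} {M : ℝ}
    (hp : ∀ i, 0 < p i ∧ p i ≤ 1) (hc : ∀ i, 0 < c i) (hpc : ∀ i, 2 * c i ≤ p i)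
    (h0 : ∀ σ ω, S σ ω ∈ Set.Icc (0 : ℝ) 1) (hS : IC p c S Ψ)
    (hM : ∀ B, Implementable p c B → ∑ i ∈ B, v i ≤ M) : ∑ i ∈ Ψ, v i ≤ 1091 * M := by
  have hM0 : 0 ≤ M := by simpa using hM ∅ (implementable_empty hp hc)
  have hsing : ∀ i, v i ≤ M := fun i => by
    simpa using hM {i} (implementable_singleton hp hc (hpc i))
  have hcost := hS.sum_cost_le_one hp h0
  rw [← sum_filter_add_sum_filter_not Ψ fun i => 4 * c i ≤ p i] at hcost ⊢
  set L := Ψ.filter fun i => 4 * c i ≤ p i with hLdef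
  set H := Ψ.filter fun i => ¬ 4 * c i ≤ p i with hHdef
  have hcL : 0 ≤ ∑ i ∈ L, c i := sum_nonneg fun i _ => (hc i).le
  have hcH : 0 ≤ ∑ i ∈ H, c i := sum_nonneg fun i _ => (hc i).le
  have hLv : ∑ i ∈ L, v i ≤ 17 * M := by
    have := mul_sum_le_of_pack (fun i => (hc i).le) (C := 1 / 8) (by norm_num) hM0
      (fun i _ => hsing i) fun B (hB : B ⊆ L) hBs => hM B <|
        implementable_of_sum_le_eighth hp hc (fun i hi => (mem_filter.1 (hB hi)).2) hBs
    nlinarith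
  have hpHs : ∑ i ∈ H, p i ≤ 4 := by
    have : ∑ i ∈ H, p i ≤ ∑ i ∈ H, 4 * c i :=
      sum_le_sum fun i hi => (not_le.1 (mem_filter.1 hi).2).le
    rw [← mul_sum] at this
    linarith
  have hHv : ∑ i ∈ H, v i ≤ 385 * M := by
    rcases H.eq_empty_or_nonempty with hH | hH
    · rw [hH, sum_empty]; positivity
    obtain ⟨i, hiH, hmin⟩ := H.exists_min_image (fun i => 1 - 2 * c i / p i) hH
    set e := 1 - 2 * c i / p i with he
    have heH : ∀ j ∈ H, p j * e ≤ p j - 2 * c j := fun j hj => by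
      have := mul_le_mul_of_nonneg_left (hmin j hj) (hp j).1.le
      rwa [mul_sub (p j) 1 (2 * c j / p j), mul_one, mul_div_cancel₀ _ (hp j).1.ne'] at this
    have hei : p i * e = p i - 2 * c i := by
      rw [he, mul_sub, mul_one, mul_div_cancel₀ _ (hp i).1.ne']
    have he0 : 0 ≤ e := sub_nonneg.2 <| (div_le_one (hp i).1).2 (hpc i)
    by_cases hlarge : 1 / 48 ≤ e
    · have := mul_sum_le_of_pack (fun i => (hp i).1.le) (C := 1 / 48) (by norm_num) hM0
        (fun i _ => hsing i) fun B (hB : B ⊆ H) hBs => hM B <|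
          implementable_of_sum_le hp hc (fun i hi => heH i (hB hi)) (hBs.trans hlarge)
      nlinarith
    rw [not_le] at hlarge
    set H₁ := H.filter fun j => ¬ p j ≤ 1 / 12 with hH₁
    set H₀ := (H.filter fun j => p j ≤ 1 / 12).erase i with hH₀
    have hH₁v : ∑ j ∈ H₁, v j ≤ 48 * M := by
      have h1 : (H₁.card : ℝ) * (1 / 12) ≤ ∑ j ∈ H₁, p j := by
        rw [← nsmul_eq_mul]
        exact card_nsmul_le_sum _ _ _ fun j hj => (not_le.1 (mem_filter.1 hj).2).le
      have h2 : ∑ j ∈ H₁, p j ≤ ∑ j ∈ H, p j :=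
        sum_le_sum_of_subset_of_nonneg (filter_subset _ _) fun j _ _ => (hp j).1.le
      have h3 := sum_le_card_nsmul H₁ v M fun j _ => hsing j
      rw [nsmul_eq_mul] at h3
      exact h3.trans (mul_le_mul_of_nonneg_right (by linarith) hM0)
    have hH₀H : H₀ ⊆ H := (erase_subset _ _).trans (filter_subset _ _)
    have hHΨ : H ⊆ Ψ := filter_subset _ _
    have hsmall : ∀ j ∈ H₀, p j ≤ 1 / 12 := fun j hj => (mem_filter.1 (mem_of_mem_erase hj)).2
    have hH₀p : ∑ j ∈ H₀, p j ≤ 16 * (e / 2) := by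
      refine sum_le_of_forall_subset (t := 1 / 4) (by linarith)
        (fun j hj => by linarith [hsmall j hj]) fun H' hH' hs => ?_
      refine sum_le_of_revExp_increment hp (fun R => (avgScore_mem_Icc h0 R).2)
        (fun i R => hS.1.avgScore_insert_le h0 i R) (hHΨ hiH) (by linarith) ?_
        (fun j hj => mem_erase.2 ⟨ne_of_mem_erase (hH' hj), hHΨ (hH₀H (hH' hj))⟩)
        (fun j hj => hsmall j (hH' hj)) (fun j hj => ?_) hs
      · refine le_of_mul_le_mul_left ?_ (hp i).1
        linarith [hS.cost_le (hHΨ hiH)]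
      · have hjH := hH₀H (hH' hj)
        refine le_of_mul_le_mul_left ?_ (hp j).1
        linarith [hS.cost_le (hHΨ hjH), not_le.1 (mem_filter.1 hjH).2]
    have hH₀v : ∑ j ∈ H₀, v j ≤ 17 * M := by
      rcases he0.eq_or_lt with h | h
      · have hemp : H₀ = ∅ := by
          by_contra hne
          have := sum_pos (fun j _ => (hp j).1) (nonempty_iff_ne_empty.2 hne)
          linarith
        rw [hemp, sum_empty]; positivity
      · have := mul_sum_le_of_pack (fun i => (hp i).1.le) h hM0
          (fun i _ => hsing i) fun B (hB : B ⊆ H₀) hBs => hM B <|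
            implementable_of_sum_le hp hc (fun i hi => heH i (hH₀H (hB hi))) hBs
        refine le_of_mul_le_mul_left ?_ h
        nlinarith
    have hsplit : ∑ j ∈ H.filter (fun j => p j ≤ 1 / 12), v j ≤ 18 * M := by
      by_cases hi : i ∈ H.filter fun j => p j ≤ 1 / 12
      · rw [← add_sum_erase _ _ hi]
        linarith [hsing i]
      · rw [hH₀, erase_eq_of_notMem hi] at hH₀v
        linarith
    rw [← sum_filter_add_sum_filter_not H fun j => p j ≤ 1 / 12]
    linarith
  linarith

end upperBound

end KS

/-- Constant approximation by simple scoring rules: the better of a truncated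
separate scoring rule and a threshold scoring rule (with budget 1) is a
`1091`-approximation to `IC-OPT` for additive values. -/
theorem stmt9 {n : ℕ} (p c v : Fin n → ℝ)
    (hp : ∀ i, 0 < p i ∧ p i ≤ 1) (hc : ∀ i, 0 < c i) (hv : ∀ i, 0 ≤ v i)
    (hpc : ∀ i, 2 * c i ≤ p i) :
    ∃ (S : KS.Sig n → KS.St n → ℝ) (Ψ : Finset (Fin n)),
      (∀ σ ω, S σ ω ∈ Set.Icc (0:ℝ) 1) ∧
      KS.IC p c S Ψ ∧
      ((∃ B > (0:ℝ), KS.IsTruncSep B S) ∨ KS.IsThreshold S) ∧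
      ∀ (S' : KS.Sig n → KS.St n → ℝ) (Ψ' : Finset (Fin n)),
        (∀ σ ω, S' σ ω ∈ Set.Icc (0:ℝ) 1) → KS.IC p c S' Ψ' →
        1091 * ∑ i ∈ Ψ, v i ≥ ∑ i ∈ Ψ', v i := by
  classical
  obtain ⟨Ψ, hΨ, hmax⟩ := (univ.filter fun Ψ => KS.Implementable p c Ψ).exists_max_image
    (fun Ψ => ∑ i ∈ Ψ, v i) ⟨∅, by simp [KS.implementable_empty hp hc]⟩
  obtain ⟨S, h0, hS, hT⟩ := (mem_filter.1 hΨ).2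
  exact ⟨S, Ψ, h0, hS, Or.inl ⟨1, one_pos, hT⟩, fun S' Ψ' h0' hS' =>
    hS'.sum_value_le hp hc hpc h0' fun B hB => hmax B (mem_filter.2 ⟨mem_univ B, hB⟩)⟩
end

section
/- (Equivalence of the threshold rule and its all-or-nothing variant) Fix Ψ ⊆ [n], an integer threshold 0 ≤ η ≤ |Ψ|, and a signal profile σ ∈ {0,1,⊥}^n whose informative coordinates are correct; let k = #{i ∈ Ψ : σ_i ≠ ⊥}. Consider the (non-proper) rule R(σ', ω) = 1 if both #{i ∈ Ψ : σ'_i ≠ ⊥} ≥ η and σ'_i = ω_i for every i ∈ Ψ with σ'_i ≠ ⊥, and R(σ', ω) = 0 otherwise. Then the maximum over reports σ' ∈ {0,1,⊥}^n of the expectation of R(σ', ω) under the posterior induced by σ equals 2^{−max(η−k, 0)}, which is exactly the score of truthful reporting under the threshold scoring rule with set Ψ and threshold η. -/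
open Finset

namespace KS

/-- Expectation of a product of functions of single tasks factorizes. -/
theorem postExp_prod {n : ℕ} (σ : Sig n) (g : Fin n → Bool → ℝ) :
    postExp σ (fun ω => ∏ i, g i (ω i)) =
      ∏ i, ∑ b : Bool, (σ i).elim ((1 : ℝ) / 2) (fun c => if b = c then 1 else 0) * g i b := by
  rw [Finset.prod_univ_sum, Fintype.piFinset_univ]
  simp only [postExp, postProb, Finset.prod_mul_distrib]

theorem sum_postProb {n : ℕ} (σ : Sig n) : ∑ ω : St n, postProb σ ω = 1 := by
  have h := postExp_prod σ (fun _ _ => 1)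
  simp only [postExp, Finset.prod_const_one, mul_one] at h
  rw [h]
  refine Finset.prod_eq_one fun i _ => ?_
  rcases σ i with _ | _ | _ <;> norm_num

theorem eq_some_of_postProb_ne_zero {n : ℕ} {σ : Sig n} {ω : St n} (h : postProb σ ω ≠ 0)
    {i : Fin n} (hi : σ i ≠ none) : σ i = some (ω i) := by
  have hf := Finset.prod_ne_zero_iff.mp h i (Finset.mem_univ i)
  obtain ⟨b, hb⟩ := Option.ne_none_iff_exists'.mp hi
  simp only [hb, Option.elim_some, ne_eq, ite_eq_right_iff, one_ne_zero, imp_false,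
    not_not] at hf
  rw [hb, hf]

/-- Probability, under the signal `s` of a task, that the report `r` is not contradicted. -/
noncomputable def matchProb (s r : Option Bool) : ℝ :=
  r.elim 1 fun b => s.elim (1 / 2) fun c => if c = b then 1 else 0

theorem matchProb_nonneg (s r : Option Bool) : 0 ≤ matchProb s r := by
  rcases s with _ | _ | _ <;> rcases r with _ | _ | _ <;> simp [matchProb]

theorem matchProb_le (s r : Option Bool) :
    matchProb s r ≤ if r ≠ none ∧ s = none then 1 / 2 else 1 := by
  rcases s with _ | _ | _ <;> rcases r with _ | _ | _ <;> simp [matchProb]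

open Classical in
/-- Probability under `σ` that the report `σ'` makes no error on `Ψ`. -/
theorem postExp_noError {n : ℕ} (Ψ : Finset (Fin n)) (σ σ' : Sig n) :
    postExp σ (fun ω => if ∀ i ∈ Ψ, σ' i ≠ none → σ' i = some (ω i) then 1 else 0) =
      ∏ i ∈ Ψ, matchProb (σ i) (σ' i) := by
  have h : (fun ω : St n =>
      if ∀ i ∈ Ψ, σ' i ≠ none → σ' i = some (ω i) then (1 : ℝ) else 0) =
      fun ω => ∏ i, if i ∈ Ψ → σ' i ≠ none → σ' i = some (ω i) then (1 : ℝ) else 0 := by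
    funext ω
    rw [Finset.prod_boole]
    simp only [Finset.mem_univ, forall_const]
  rw [h, postExp_prod σ fun i b => if i ∈ Ψ → σ' i ≠ none → σ' i = some b then 1 else 0,
    ← Finset.prod_subset (Finset.subset_univ Ψ)]
  · refine Finset.prod_congr rfl fun i hi => ?_
    rcases σ i with _ | _ | _ <;> rcases σ' i with _ | _ | _ <;> simp [matchProb, hi]
  · intro i _ hi
    rcases σ i with _ | _ | _ <;> norm_num [hi]

end KS

open Classical in
/-- Equivalence of the threshold scoring rule and its all-or-nothing variant:
the best achievable expected score of the all-or-nothing rule `R` under the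
posterior induced by `σ` is `2^{-(η−k)⁺}` where `k` is the number of informative
coordinates of `σ` in `Ψ` — exactly the expected score of truthful reporting
under the threshold scoring rule. -/
theorem stmt15 {n : ℕ} (Ψ : Finset (Fin n)) (η : ℕ) (hη : η ≤ Ψ.card)
    (σ : KS.Sig n)
    (k : ℕ) (hk : k = (Ψ.filter fun i => σ i ≠ none).card)
    (R : KS.Sig n → KS.St n → ℝ)
    (hR : ∀ σ' ω, R σ' ω =
      if η ≤ (Ψ.filter fun i => σ' i ≠ none).card ∧
          (∀ i ∈ Ψ, σ' i ≠ none → σ' i = some (ω i)) then 1 else 0) :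
    IsGreatest {x : ℝ | ∃ σ' : KS.Sig n, x = KS.postExp σ (R σ')} ((1/2 : ℝ) ^ (η - k)) ∧
    KS.postExp σ (KS.thresholdScore Ψ η σ) = (1/2 : ℝ) ^ (η - k) := by
  have hpost : ∀ σ' : KS.Sig n, KS.postExp σ (R σ') =
      if η ≤ (Ψ.filter fun i => σ' i ≠ none).card then
        ∏ i ∈ Ψ, KS.matchProb (σ i) (σ' i) else 0 := by
    intro σ'
    rw [← KS.postExp_noError]
    by_cases hc : η ≤ (Ψ.filter fun i => σ' i ≠ none).card
    · simp only [KS.postExp, hR, hc, true_and, if_true]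
    · simp only [KS.postExp, hR, hc, false_and, if_false, mul_zero, Finset.sum_const_zero]
  refine ⟨⟨?_, ?_⟩, ?_⟩
  · obtain ⟨T, hKT, hTΨ, hT⟩ := Finset.exists_subsuperset_card_eq
      (Finset.filter_subset (fun i => σ i ≠ none) Ψ)
      (n := max η k) (hk ▸ le_max_right _ _)
      (max_le hη (hk ▸ Finset.card_filter_le _ _))
    refine ⟨fun i => if i ∈ T then some ((σ i).getD true) else none, ?_⟩
    have hfilter : (Ψ.filter fun i =>
        (if i ∈ T then some ((σ i).getD true) else none) ≠ none) = T := by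
      ext i
      have := @hTΨ i
      by_cases hi : i ∈ T <;> simp_all
    have hterm : ∀ i ∈ Ψ, KS.matchProb (σ i) (if i ∈ T then some ((σ i).getD true) else none) =
        if i ∈ T \ Ψ.filter (fun i => σ i ≠ none) then 1 / 2 else 1 := by
      intro i hi
      by_cases hiT : i ∈ T <;> rcases hs : σ i with _ | b <;>
        simp [KS.matchProb, hi, hiT, hs]
    rw [hpost, hfilter, if_pos (hT ▸ le_max_left _ _), Finset.prod_congr rfl hterm,
      Finset.prod_ite_mem, Finset.inter_eq_right.mpr (Finset.sdiff_subset.trans hTΨ),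
      Finset.prod_const, Finset.card_sdiff_of_subset hKT, hT, ← hk]
    congr 1
    omega
  · rintro x ⟨σ', rfl⟩
    rw [hpost]
    split_ifs with hc
    · calc ∏ i ∈ Ψ, KS.matchProb (σ i) (σ' i)
          ≤ ∏ i ∈ Ψ, if σ' i ≠ none ∧ σ i = none then (1 / 2 : ℝ) else 1 :=
            Finset.prod_le_prod (fun i _ => KS.matchProb_nonneg _ _)
              fun i _ => KS.matchProb_le _ _
        _ = (1 / 2 : ℝ) ^ (Ψ.filter fun i => σ' i ≠ none ∧ σ i = none).card := by
            rw [← Finset.prod_filter, Finset.prod_const]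
        _ ≤ (1 / 2 : ℝ) ^ (η - k) := by
            refine pow_le_pow_of_le_one (by norm_num) (by norm_num) ?_
            have hsub : (Ψ.filter fun i => σ' i ≠ none) ⊆
                (Ψ.filter fun i => σ' i ≠ none ∧ σ i = none) ∪
                  Ψ.filter fun i => σ i ≠ none := by
              intro i
              simp only [Finset.mem_union, Finset.mem_filter]
              tauto
            have := (Finset.card_le_card hsub).trans (Finset.card_union_le _ _)
            omega
    · positivity
  · have hscore : ∀ ω, KS.postProb σ ω * KS.thresholdScore Ψ η σ ω =
        KS.postProb σ ω * (1 / 2 : ℝ) ^ (η - k) := by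
      intro ω
      by_cases hω : KS.postProb σ ω = 0
      · simp only [hω, zero_mul]
      have hcorrect := fun i => KS.eq_some_of_postProb_ne_zero hω (i := i)
      have hcard : (Ψ.filter fun i => σ i = some (ω i)).card = k := by
        rw [hk]
        congr 1
        refine Finset.filter_congr fun i _ => ⟨fun h => ?_, hcorrect i⟩
        rw [h]
        exact Option.some_ne_none _
      rw [KS.thresholdScore, if_neg fun ⟨i, _, h, h'⟩ => h' (hcorrect i h), hcard]
      split_ifs with hle
      · rw [Nat.sub_eq_zero_of_le hle, pow_zero]
      · rfl
    rw [KS.postExp, Finset.sum_congr rfl fun ω _ => hscore ω, ← Finset.sum_mul,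
      KS.sum_postProb, one_mul]
end
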